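/- Let n ≥ 1 and let G be a discrete subgroup of PU(1,n). For every compact set K ⊆ Eq(G), every cluster point of the orbit G·K lies in the Chen–Greenberg limit set Λ_CG(G); that is, if (g_m) is a sequence of distinct elements of G, (k_m) is a sequence in K, and g_m(k_m) converges to a point z ∈ ℙⁿ_ℂ, then z ∈ Λ_CG(G). -/

import Mathlib

open Filter Topology Matrix

noncomputable section

abbrev Vec (n : ℕ) := Fin (n + 1) → ℂ
abbrev Mat (n : ℕ) := Matrix (Fin (n + 1)) (Fin (n + 1)) ℂ
abbrev Pn (n : ℕ) := Projectivization ℂ (Vec n)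

instance (n : ℕ) : TopologicalSpace (Pn n) :=
  inferInstanceAs (TopologicalSpace (Quotient (projectivizationSetoid ℂ (Vec n))))

def herm (n : ℕ) (u v : Vec n) : ℂ :=
  -(u 0 * (starRingEnd ℂ) (v 0)) + ∑ j : Fin n, u j.succ * (starRingEnd ℂ) (v j.succ)

def Hball (n : ℕ) : Set (Pn n) :=
  {p | ∃ v : Vec n, ∃ hv : v ≠ 0, p = Projectivization.mk ℂ v hv ∧ (herm n v v).re < 0}

def Hbdry (n : ℕ) : Set (Pn n) :=
  {p | ∃ v : Vec n, ∃ hv : v ≠ 0, p = Projectivization.mk ℂ v hv ∧ herm n v v = 0}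

abbrev GLn (n : ℕ) := Matrix.GeneralLinearGroup (Fin (n + 1)) ℂ
abbrev PGLn (n : ℕ) := GLn n ⧸ Subgroup.center (GLn n)

lemma glInj {n : ℕ} (A : GLn n) : Function.Injective (Matrix.mulVecLin (A : Mat n)) := by
  intro x y h
  simp only [Matrix.mulVecLin_apply] at h
  have h2 : ((A⁻¹ : GLn n) : Mat n) *ᵥ ((A : Mat n) *ᵥ x)
      = ((A⁻¹ : GLn n) : Mat n) *ᵥ ((A : Mat n) *ᵥ y) := by rw [h]
  rwa [Matrix.mulVec_mulVec, Matrix.mulVec_mulVec, Units.inv_mul, Matrix.one_mulVec,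
    Matrix.one_mulVec] at h2

def actGL {n : ℕ} (A : GLn n) : Pn n → Pn n :=
  Projectivization.map (Matrix.mulVecLin (A : Mat n)) (glInj A)

def act {n : ℕ} (g : PGLn n) : Pn n → Pn n := actGL (Quotient.out g)

-- part 2 --

/-- The subset `U(1,n)` of `GL(n+1,ℂ)`: matrices preserving the Hermitian form. -/
def unitaryGL (n : ℕ) : Set (GLn n) :=
  {A | ∀ u v : Vec n, herm n ((A : Mat n) *ᵥ u) ((A : Mat n) *ᵥ v) = herm n u v}

/-- `PU(1,n)`, the image of `U(1,n)` in `PGL(n+1,ℂ)`. -/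
def PUset (n : ℕ) : Set (PGLn n) := (QuotientGroup.mk : GLn n → PGLn n) '' unitaryGL n

/-- The center of the ball `𝐇ⁿ_ℂ`, namely the image of `(1,0,…,0)`. -/
def basePt (n : ℕ) : Pn n :=
  Projectivization.mk ℂ (Pi.single 0 1) (by
    intro h
    have := congrFun h 0
    simp [Pi.single_eq_same] at this)

lemma basePt_mem_Hball (n : ℕ) : basePt n ∈ Hball n := by
  refine ⟨Pi.single 0 1, _, rfl, ?_⟩
  have : herm n (Pi.single 0 1) (Pi.single 0 1) = -1 := by
    simp [herm, Pi.single_eq_same, Pi.single_eq_of_ne (Fin.succ_ne_zero _)]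
  rw [this]
  norm_num

/-- The set of accumulation points of the orbit `G • x` in `ℙⁿ_ℂ`: limits of
`g_m • x` along sequences of pairwise distinct elements of `G`. -/
def accPts {n : ℕ} (G : Subgroup (PGLn n)) (x : Pn n) : Set (Pn n) :=
  {z | ∃ g : ℕ → G, Function.Injective g ∧
    Tendsto (fun m => act (g m : PGLn n) x) atTop (𝓝 z)}

/-- The Chen–Greenberg limit set of `G`. -/
def LambdaCG {n : ℕ} (G : Subgroup (PGLn n)) : Set (Pn n) := accPts G (basePt n)

/-- Uniform convergence on `K` of a sequence of self-maps of `ℙⁿ_ℂ` to `F`, expressed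
via open neighborhoods of the diagonal.  Since `ℙⁿ_ℂ` is compact Hausdorff, this is
equivalent to uniform convergence on `K` with respect to any metric inducing its
topology. -/
def UnifConvOn {n : ℕ} (f : ℕ → Pn n → Pn n) (F : Pn n → Pn n) (K : Set (Pn n)) : Prop :=
  ∀ W : Set (Pn n × Pn n), IsOpen W → (∀ y, (y, y) ∈ W) →
    ∀ᶠ m in atTop, ∀ x ∈ K, (F x, f m x) ∈ W

/-- Uniform convergence on all compact subsets of `S`. -/
def UnifConvOnCompacts {n : ℕ} (f : ℕ → Pn n → Pn n) (F : Pn n → Pn n)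
    (S : Set (Pn n)) : Prop :=
  ∀ K ⊆ S, IsCompact K → UnifConvOn f F K

/-- The equicontinuity region of a subgroup `G ≤ PGL(n+1,ℂ)`: points having an open
neighborhood `U` on which every sequence in `G` has a subsequence converging uniformly
on compact subsets of `U`. -/
def eqRegion {n : ℕ} (G : Subgroup (PGLn n)) : Set (Pn n) :=
  {z | ∃ U : Set (Pn n), IsOpen U ∧ z ∈ U ∧
    ∀ g : ℕ → G, ∃ φ : ℕ → ℕ, StrictMono φ ∧ ∃ F : Pn n → Pn n,
      UnifConvOnCompacts (fun m => act (g (φ m) : PGLn n)) F U}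

/-- The equicontinuity region of the family of maps `{f m : m ∈ ℕ}`. -/
def eqRegionFam {n : ℕ} (f : ℕ → Pn n → Pn n) : Set (Pn n) :=
  {z | ∃ U : Set (Pn n), IsOpen U ∧ z ∈ U ∧
    ∀ s : ℕ → ℕ, ∃ φ : ℕ → ℕ, StrictMono φ ∧ ∃ F : Pn n → Pn n,
      UnifConvOnCompacts (fun k => f (s (φ k))) F U}

/-- The projectivization of a linear subspace `W ⊆ ℂ^{n+1}`, as a subset of `ℙⁿ_ℂ`. -/
def projSet {n : ℕ} (W : Submodule ℂ (Vec n)) : Set (Pn n) := {p | p.rep ∈ W}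

/-- A complex projective hyperplane: the projectivization of an `n`-dimensional
subspace of `ℂ^{n+1}`. -/
def IsProjHyperplane {n : ℕ} (S : Set (Pn n)) : Prop :=
  ∃ W : Submodule ℂ (Vec n), Module.finrank ℂ W = n ∧ S = projSet W

/-- A complex projective line: the projectivization of a `2`-dimensional subspace. -/
def IsProjLine {n : ℕ} (S : Set (Pn n)) : Prop :=
  ∃ W : Submodule ℂ (Vec n), Module.finrank ℂ W = 2 ∧ S = projSet W

/-- The kernel in `ℙⁿ_ℂ` of the quasi-projective map induced by the nonzero matrix `M`. -/
def qKer {n : ℕ} (M : Mat n) : Set (Pn n) := projSet (LinearMap.ker (Matrix.mulVecLin M))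

/-- The image in `ℙⁿ_ℂ` of the quasi-projective map induced by the nonzero matrix `M`. -/
def qIm {n : ℕ} (M : Mat n) : Set (Pn n) := projSet (LinearMap.range (Matrix.mulVecLin M))

/-- The quasi-projective map `ℙⁿ_ℂ ∖ Ker(M) → ℙⁿ_ℂ` induced by the nonzero matrix `M`
(extended to all of `ℙⁿ_ℂ` by the identity on `Ker(M)`, where it is irrelevant). -/
def qMap {n : ℕ} (M : Mat n) : Pn n → Pn n := fun p =>
  if h : M *ᵥ p.rep ≠ 0 then Projectivization.mk ℂ (M *ᵥ p.rep) h else p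

/-- Convergence of a sequence of transformations of `ℙⁿ_ℂ` to the quasi-projective map
induced by `M`, in the sense of quasi-projective transformations: uniform convergence
on compact subsets of `ℙⁿ_ℂ ∖ Ker(M)`. -/
def QPConv {n : ℕ} (f : ℕ → Pn n → Pn n) (M : Mat n) : Prop :=
  UnifConvOnCompacts f (qMap M) (qKer M)ᶜ

/-- The special linear group `SL(n+1,ℂ)`. -/
abbrev SLn (n : ℕ) := Matrix.SpecialLinearGroup (Fin (n + 1)) ℂ

/-- The projective special linear group `PSL(n+1,ℂ) = SL(n+1,ℂ)/center`. -/
abbrev PSLn (n : ℕ) := SLn n ⧸ Subgroup.center (SLn n)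

/-- The projective transformation induced by an element of `SL(n+1,ℂ)`. -/
def actSL {n : ℕ} (A : SLn n) : Pn n → Pn n := actGL (Matrix.SpecialLinearGroup.toGL A)

/-- The projective transformation induced by an element of `PSL(n+1,ℂ)` (via an
arbitrary representative; all representatives induce the same transformation). -/
def actPSL {n : ℕ} (g : PSLn n) : Pn n → Pn n := actSL (Quotient.out g)

/-- The projective hyperplane tangent to `∂𝐇ⁿ_ℂ` at `p`: the projectivization of the
Hermitian orthogonal complement of a lift of `p`. -/
def tangentAt {n : ℕ} (p : Pn n) : Set (Pn n) := {q | herm n q.rep p.rep = 0}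

end

section ProjectiveTopology

variable {n : ℕ}

lemma continuous_mk_subtype :
    Continuous (fun v : {v : Vec n // v ≠ 0} => Projectivization.mk ℂ v.1 v.2) :=
  continuous_quot_mk

lemma isOpenQuotientMap_mk_subtype :
    IsOpenQuotientMap (fun v : {v : Vec n // v ≠ 0} => Projectivization.mk ℂ v.1 v.2) := by
  refine ⟨fun p => ⟨⟨p.rep, p.rep_nonzero⟩, p.mk_rep⟩, continuous_mk_subtype, fun s hs => ?_⟩
  have hq : IsQuotientMap
      (fun v : {v : Vec n // v ≠ 0} => Projectivization.mk ℂ v.1 v.2) := isQuotientMap_quot_mk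
  rw [← hq.isOpen_preimage]
  have h : (fun v : {v : Vec n // v ≠ 0} => Projectivization.mk ℂ v.1 v.2) ⁻¹'
      ((fun v : {v : Vec n // v ≠ 0} => Projectivization.mk ℂ v.1 v.2) '' s) =
      ⋃ c : ℂˣ, (fun v : {v : Vec n // v ≠ 0} =>
        (⟨c • v.1, (smul_ne_zero_iff_ne c).2 v.2⟩ : {v : Vec n // v ≠ 0})) ⁻¹' s := by
    ext v
    simp only [Set.mem_preimage, Set.mem_image, Set.mem_iUnion, Projectivization.mk_eq_mk_iff]
    constructor
    · rintro ⟨w, hw, c, hc⟩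
      refine ⟨c, ?_⟩
      convert hw using 1
      exact Subtype.ext hc
    · rintro ⟨c, hc⟩
      exact ⟨_, hc, c, rfl⟩
  rw [h]
  refine isOpen_iUnion fun c => hs.preimage ?_
  exact (continuous_subtype_val.const_smul c).subtype_mk _

lemma mk_eq_mk_iff_cross (v w : Vec n) (hv : v ≠ 0) (hw : w ≠ 0) :
    Projectivization.mk ℂ v hv = Projectivization.mk ℂ w hw ↔ ∀ i j, v i * w j = v j * w i := by
  rw [Projectivization.mk_eq_mk_iff']
  constructor
  · rintro ⟨a, rfl⟩ i j
    simp only [Pi.smul_apply, smul_eq_mul]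
    ring
  · intro h
    obtain ⟨i, hi⟩ := Function.ne_iff.1 hw
    simp only [Pi.zero_apply] at hi
    refine ⟨v i / w i, ?_⟩
    ext j
    simp only [Pi.smul_apply, smul_eq_mul]
    field_simp
    exact (h i j).trans (mul_comm _ _)

instance instT2SpacePn : T2Space (Pn n) := by
  rw [t2Space_iff_of_isOpenQuotientMap isOpenQuotientMap_mk_subtype]
  simp only [mk_eq_mk_iff_cross, Set.ofPred_forall]
  refine isClosed_iInter fun i => isClosed_iInter fun j => isClosed_eq ?_ ?_
  all_goals
    exact ((continuous_apply _).comp (continuous_subtype_val.comp continuous_fst)).mul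
      ((continuous_apply _).comp (continuous_subtype_val.comp continuous_snd))

instance instFirstCountablePn : FirstCountableTopology (Pn n) := by
  have hq := isOpenQuotientMap_mk_subtype (n := n)
  constructor
  intro p
  obtain ⟨v, rfl⟩ := hq.surjective p
  rw [← hq.isOpenMap.map_nhds_eq hq.continuous.continuousAt]
  infer_instance

lemma tendsto_mk {v : ℕ → Vec n} (hv : ∀ m, v m ≠ 0) {w : Vec n} (hw : w ≠ 0)
    (h : Tendsto v atTop (𝓝 w)) :
    Tendsto (fun m => Projectivization.mk ℂ (v m) (hv m)) atTop
      (𝓝 (Projectivization.mk ℂ w hw)) :=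
  (continuous_mk_subtype.tendsto ⟨w, hw⟩).comp
    (tendsto_subtype_rng.2 h : Tendsto (fun m => (⟨v m, hv m⟩ : {v : Vec n // v ≠ 0})) _ _)

lemma mulVec_ne_zero_of_ne_zero (A : GLn n) {v : Vec n} (hv : v ≠ 0) : (A : Mat n) *ᵥ v ≠ 0 :=
  fun h => hv (glInj A (by simpa using h))

lemma actGL_mk (A : GLn n) (v : Vec n) (hv : v ≠ 0) :
    actGL A (Projectivization.mk ℂ v hv) =
      Projectivization.mk ℂ ((A : Mat n) *ᵥ v) (mulVec_ne_zero_of_ne_zero A hv) := rfl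

lemma continuous_actGL (A : GLn n) : Continuous (actGL A) := by
  rw [isOpenQuotientMap_mk_subtype.isQuotientMap.continuous_iff]
  refine continuous_mk_subtype.comp
    (f := fun v : {v : Vec n // v ≠ 0} => ⟨(A : Mat n) *ᵥ v.1, mulVec_ne_zero_of_ne_zero A v.2⟩) ?_
  exact (continuous_const.matrix_mulVec continuous_subtype_val).subtype_mk _

lemma act_mk (A : GLn n) : act (QuotientGroup.mk A : PGLn n) = actGL A := by
  obtain ⟨⟨c, hc⟩, hcA⟩ := QuotientGroup.mk_out_eq_mul (Subgroup.center (GLn n)) A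
  obtain ⟨a, ha⟩ := Matrix.GeneralLinearGroup.mem_center_iff_val_mem_range_scalar.1 hc
  funext p
  induction p using Projectivization.ind with
  | h v hv =>
    have hA : Quotient.out (QuotientGroup.mk A : PGLn n) = A * c := hcA
    rw [act, hA, actGL_mk, actGL_mk, Projectivization.mk_eq_mk_iff']
    refine ⟨a, ?_⟩
    rw [Units.val_mul, ← ha, ← Matrix.mulVec_mulVec]
    simp [← Matrix.smul_one_eq_diagonal, Matrix.smul_mulVec, Matrix.mulVec_smul]

end ProjectiveTopology

section UniformConvergence

variable {n : ℕ} {f : ℕ → Pn n → Pn n} {F : Pn n → Pn n}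

lemma UnifConvOn.eventually_mem {S : Set (Pn n)} (h : UnifConvOn f F S) {c : Pn n}
    {O : Set (Pn n)} (hO : IsOpen O) (hc : c ∈ O) :
    ∀ᶠ m in atTop, ∀ x ∈ S, F x = c → f m x ∈ O := by
  have hW := h ({c} ×ˢ Oᶜ)ᶜ (isClosed_singleton.prod hO.isClosed_compl).isOpen_compl (by
    rintro y ⟨hy, hyO⟩
    obtain rfl : y = c := hy
    exact hyO hc)
  filter_upwards [hW] with m hm x hx hFx
  by_contra hxO
  exact hm x hx ⟨hFx, hxO⟩

lemma UnifConvOnCompacts.tendsto {U : Set (Pn n)} (h : UnifConvOnCompacts f F U) {x : Pn n}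
    (hx : x ∈ U) : Tendsto (fun m => f m x) atTop (𝓝 (F x)) := by
  refine tendsto_nhds.2 fun O hO hxO => ?_
  filter_upwards [(h {x} (by simpa using hx) isCompact_singleton).eventually_mem hO hxO] with m hm
  exact hm x rfl rfl

/-- A sequence tending to a point of an open set has, up to finitely many terms, a compact
closure in that open set. -/
lemma exists_isCompact_insert_range {X : Type*} [TopologicalSpace X] {U : Set X} (hU : IsOpen U)
    {x : X} (hx : x ∈ U) {y : ℕ → X} (hy : Tendsto y atTop (𝓝 x)) :
    ∃ S ⊆ U, IsCompact S ∧ x ∈ S ∧ ∀ᶠ j in atTop, y j ∈ S := by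
  obtain ⟨N, hN⟩ := eventually_atTop.1 (hy.eventually_mem (hU.mem_nhds hx))
  refine ⟨insert x (Set.range fun j => y (j + N)), ?_,
    ((tendsto_add_atTop_iff_nat N).2 hy).isCompact_insert_range, Set.mem_insert _ _, ?_⟩
  · rintro _ (rfl | ⟨j, rfl⟩)
    · exact hx
    · exact hN _ (Nat.le_add_left _ _)
  · filter_upwards [eventually_ge_atTop N] with j hj
    exact Or.inr ⟨j - N, by simp [Nat.sub_add_cancel hj]⟩

lemma UnifConvOnCompacts.eq_of_tendsto_of_dense {U : Set (Pn n)} (hU : IsOpen U)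
    (h : UnifConvOnCompacts f F U) (hf : ∀ m, Continuous (f m)) {p x : Pn n} (hx : x ∈ U)
    {y : ℕ → Pn n} (hy : Tendsto y atTop (𝓝 x))
    (hfy : ∀ j, Tendsto (fun m => f m (y j)) atTop (𝓝 p)) : F x = p := by
  by_contra hne
  obtain ⟨O₁, O₂, hO₁, hO₂, hxO, hpO, hdisj⟩ := t2_separation hne
  obtain ⟨S, hSU, hS, hxS, hyS⟩ := exists_isCompact_insert_range hU hx hy
  obtain ⟨m, hm₁, hm₂⟩ := (((h S hSU hS).eventually_mem hO₁ hxO).and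
    ((h S hSU hS).eventually_mem hO₂ hpO)).exists
  obtain ⟨j, hj, hjS⟩ := (((((hf m).tendsto x).comp hy).eventually_mem
    (hO₁.mem_nhds (hm₁ x hxS rfl))).and hyS).exists
  have hFy : F (y j) = p := tendsto_nhds_unique (h.tendsto (hSU hjS)) (hfy j)
  exact Set.disjoint_left.1 hdisj hj (hm₂ _ hjS hFy)

lemma UnifConvOnCompacts.tendsto_of_eq_const {U : Set (Pn n)} (hU : IsOpen U)
    (h : UnifConvOnCompacts f F U) {p x : Pn n} (hF : ∀ y ∈ U, F y = p) (hx : x ∈ U)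
    {y : ℕ → Pn n} (hy : Tendsto y atTop (𝓝 x)) :
    Tendsto (fun m => f m (y m)) atTop (𝓝 p) := by
  refine tendsto_nhds.2 fun O hO hpO => ?_
  obtain ⟨S, hSU, hS, -, hyS⟩ := exists_isCompact_insert_range hU hx hy
  filter_upwards [(h S hSU hS).eventually_mem hO hpO, hyS] with m hm hmS
  exact hm _ hmS (hF _ (hSU hmS))

end UniformConvergence

section HermitianForm

variable {n : ℕ}

/-- The Gram matrix `diag(-1, 1, …, 1)` of the Hermitian form. -/
def hermMat (n : ℕ) : Mat n := Matrix.diagonal (Fin.cons (-1) fun _ => 1)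

lemma hermMat_mul_self : hermMat n * hermMat n = 1 := by
  rw [hermMat, Matrix.diagonal_mul_diagonal, ← Matrix.diagonal_one]
  congr 1
  ext i
  cases i using Fin.cases <;> simp

lemma herm_eq_dotProduct (u v : Vec n) : herm n u v = star v ⬝ᵥ (hermMat n *ᵥ u) := by
  simp [herm, hermMat, dotProduct, Matrix.mulVec_diagonal, Fin.sum_univ_succ, mul_comm]

lemma conjTranspose_mul_hermMat_mul {A : GLn n} (hA : A ∈ unitaryGL n) :
    (A : Mat n)ᴴ * hermMat n * (A : Mat n) = hermMat n := by
  refine Matrix.ext_of_mulVec_single fun j => ?_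
  refine dotProduct_eq _ _ fun w => ?_
  have h := hA (Pi.single j 1) (star w)
  rw [herm_eq_dotProduct, herm_eq_dotProduct, Matrix.star_mulVec, star_star,
    ← Matrix.dotProduct_mulVec, Matrix.mulVec_mulVec, Matrix.mulVec_mulVec] at h
  rw [dotProduct_comm, h, dotProduct_comm]

lemma inv_val_eq {A : GLn n} (hA : A ∈ unitaryGL n) :
    ((A⁻¹ : GLn n) : Mat n) = hermMat n * (A : Mat n)ᴴ * hermMat n := by
  have h : (hermMat n * (A : Mat n)ᴴ * hermMat n) * (A : Mat n) = 1 := by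
    rw [mul_assoc (hermMat n), mul_assoc (hermMat n), conjTranspose_mul_hermMat_mul hA,
      hermMat_mul_self]
  exact (left_inv_eq_right_inv h A.mul_inv).symm

lemma mul_hermMat_mul_conjTranspose {A : GLn n} (hA : A ∈ unitaryGL n) :
    (A : Mat n) * hermMat n * (A : Mat n)ᴴ = hermMat n := by
  have h : (A : Mat n) * (hermMat n * (A : Mat n)ᴴ * hermMat n) = 1 := by
    rw [← inv_val_eq hA, Units.mul_inv]
  calc (A : Mat n) * hermMat n * (A : Mat n)ᴴ
      = (A : Mat n) * (hermMat n * (A : Mat n)ᴴ * hermMat n) * hermMat n := by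
        simp only [mul_assoc, hermMat_mul_self, mul_one]
    _ = hermMat n := by rw [h, one_mul]

/-- An isotropic vector with vanishing zeroth coordinate is zero. -/
lemma eq_zero_of_herm_self {v : Vec n} (h : herm n v v = 0) (h0 : v 0 = 0) : v = 0 := by
  have h' : ∑ j : Fin n, Complex.normSq (v j.succ) = 0 := by
    have : ((∑ j : Fin n, Complex.normSq (v j.succ) : ℝ) : ℂ) = 0 := by
      simpa [herm, h0, Complex.mul_conj] using h
    exact_mod_cast this
  rw [Finset.sum_eq_zero_iff_of_nonneg fun _ _ => Complex.normSq_nonneg _] at h'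
  funext i
  cases i using Fin.cases with
  | zero => exact h0
  | succ j => exact Complex.normSq_eq_zero.1 (h' j (Finset.mem_univ _))

lemma herm_mulVec_self_eq_zero {B : Mat n} (hB : Bᴴ * hermMat n * B = 0) (v : Vec n) :
    herm n (B *ᵥ v) (B *ᵥ v) = 0 := by
  rw [herm_eq_dotProduct, Matrix.star_mulVec, ← Matrix.dotProduct_mulVec, Matrix.mulVec_mulVec,
    Matrix.mulVec_mulVec, hB, Matrix.zero_mulVec, dotProduct_zero]

/-- The range of `B` is isotropic if `Bᴴ J B = 0`, so it is at most a line. -/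
lemma mulVec_parallel {B : Mat n} (hB : Bᴴ * hermMat n * B = 0) (u v : Vec n) :
    (B *ᵥ u) 0 • (B *ᵥ v) = (B *ᵥ v) 0 • (B *ᵥ u) := by
  rw [← sub_eq_zero, ← Matrix.mulVec_smul, ← Matrix.mulVec_smul, ← Matrix.mulVec_sub]
  refine eq_zero_of_herm_self (herm_mulVec_self_eq_zero hB _) ?_
  simp only [Matrix.mulVec_sub, Matrix.mulVec_smul, Pi.sub_apply, Pi.smul_apply, smul_eq_mul]
  ring

/-- The rows of `B` are isotropic if `B J Bᴴ = 0`, so the zeroth column of `B` cannot vanish. -/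
lemma mulVec_single_zero_ne_zero {B : Mat n} (hB : B * hermMat n * Bᴴ = 0) (hB0 : B ≠ 0) :
    B *ᵥ Pi.single 0 1 ≠ 0 := by
  intro h
  refine hB0 ?_
  ext i j
  have hrow : herm n (B i) (B i) = 0 := by
    have := congrFun (congrFun hB i) i
    rw [hermMat, Matrix.mul_apply] at this
    simp only [Matrix.mul_diagonal, Matrix.conjTranspose_apply, Fin.sum_univ_succ] at this
    simpa [herm] using this
  have hi0 : B i 0 = 0 := by simpa using congrFun h i
  exact congrFun (eq_zero_of_herm_self hrow hi0) j

end HermitianForm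

section Normalization

attribute [local instance] Matrix.normedAddCommGroup Matrix.normedSpace

variable {n : ℕ}

lemma exists_subseq_tendsto_of_bounded {U : ℕ → Mat n} {R : ℝ} (h : ∀ m, ‖U m‖ ≤ R) :
    ∃ A : Mat n, ∃ φ : ℕ → ℕ, StrictMono φ ∧ Tendsto (U ∘ φ) atTop (𝓝 A) := by
  have : ProperSpace (Mat n) := FiniteDimensional.proper ℂ _
  obtain ⟨A, -, φ, hφ, hA⟩ := tendsto_subseq_of_bounded
    (Metric.isBounded_closedBall (x := (0 : Mat n)) (r := R)) (x := U) (by simpa using h)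
  exact ⟨A, φ, hφ, hA⟩

/-- A bounded sequence in `U(1,n)` subconverges in `GL(n+1,ℂ)`. -/
lemma exists_subseq_tendsto_GL {U : ℕ → GLn n} (hU : ∀ m, U m ∈ unitaryGL n) {R : ℝ}
    (h : ∀ m, ‖(U m : Mat n)‖ ≤ R) :
    ∃ A : GLn n, ∃ φ : ℕ → ℕ, StrictMono φ ∧ Tendsto (U ∘ φ) atTop (𝓝 A) := by
  obtain ⟨A, φ, hφ, hA⟩ := exists_subseq_tendsto_of_bounded h
  have hinv : Tendsto (fun m => ((U (φ m))⁻¹ : GLn n).val) atTop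
      (𝓝 (hermMat n * Aᴴ * hermMat n)) := by
    have hc : Continuous fun M : Mat n => hermMat n * Mᴴ * hermMat n :=
      (continuous_const.matrix_mul continuous_id.matrix_conjTranspose).matrix_mul continuous_const
    exact ((hc.tendsto A).comp hA).congr fun m => (inv_val_eq (hU (φ m))).symm
  have h1 : A * (hermMat n * Aᴴ * hermMat n) = 1 := by
    have hmul := Filter.Tendsto.mul hA hinv
    simp only [Function.comp_apply, Units.mul_inv, tendsto_const_nhds_iff] at hmul
    exact hmul.symm
  refine ⟨⟨A, _, h1, mul_eq_one_comm.1 h1⟩, φ, hφ, ?_⟩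
  rw [Units.isInducing_embedProduct.tendsto_nhds_iff]
  exact hA.prodMk_nhds ((MulOpposite.continuous_op.tendsto _).comp hinv)

lemma tendsto_norm_atTop {G : Subgroup (PGLn n)} (hdisc : DiscreteTopology ↥G)
    {g : ℕ → G} (hg : Function.Injective g) {U : ℕ → GLn n} (hU : ∀ m, U m ∈ unitaryGL n)
    (hUg : ∀ m, (QuotientGroup.mk (U m) : PGLn n) = g m) :
    Tendsto (fun m => ‖(U m : Mat n)‖) atTop atTop := by
  by_contra hnot
  simp only [tendsto_atTop, not_forall, not_eventually, not_le] at hnot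
  obtain ⟨R, hR⟩ := hnot
  obtain ⟨φ, hφ, hφR⟩ := extraction_of_frequently_atTop hR
  obtain ⟨A, ψ, hψ, hA⟩ := exists_subseq_tendsto_GL (fun m => hU (φ m)) fun m => (hφR m).le
  have hlim : Tendsto (fun m => ((g (φ (ψ m)) : G) : PGLn n)) atTop
      (𝓝 (QuotientGroup.mk A)) := by
    simp only [← hUg]
    exact (QuotientGroup.continuous_mk.tendsto A).comp hA
  have hquot : Tendsto (fun m => g (φ (ψ (m + 1))) * (g (φ (ψ m)))⁻¹) atTop (𝓝 1) := by
    rw [tendsto_subtype_rng]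
    simpa using ((tendsto_add_atTop_iff_nat 1).2 hlim).mul hlim.inv
  rw [nhds_discrete, tendsto_pure] at hquot
  obtain ⟨m, hm⟩ := hquot.exists
  have := hψ.injective (hφ.injective (hg (mul_inv_eq_one.1 hm)))
  omega

/-- Elements of `U(1,n)` whose norms tend to infinity, once normalized, subconverge to a nonzero
matrix with isotropic columns and isotropic rows. -/
lemma exists_subseq_normalized_tendsto {U : ℕ → GLn n} (hU : ∀ m, U m ∈ unitaryGL n)
    (hnorm : Tendsto (fun m => ‖(U m : Mat n)‖) atTop atTop) :
    ∃ (B : Mat n) (φ : ℕ → ℕ) (c : ℕ → ℂ), StrictMono φ ∧ B ≠ 0 ∧ Bᴴ * hermMat n * B = 0 ∧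
      B * hermMat n * Bᴴ = 0 ∧ (∀ m, c m ≠ 0) ∧
      Tendsto (fun m => c m • (U (φ m) : Mat n)) atTop (𝓝 B) := by
  have hne : ∀ m, (U m : Mat n) ≠ 0 := fun m => (U m).ne_zero
  set V : ℕ → Mat n := fun m => ((‖(U m : Mat n)‖⁻¹ : ℝ) : ℂ) • (U m : Mat n) with hV
  have hV1 : ∀ m, ‖V m‖ = 1 := fun m => by
    rw [hV, norm_smul, Complex.norm_real, norm_inv, norm_norm,
      inv_mul_cancel₀ (norm_ne_zero_iff.2 (hne m))]
  obtain ⟨B, φ, hφ, hB⟩ := exists_subseq_tendsto_of_bounded fun m => (hV1 m).le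
  have hscal : Tendsto (fun m => ((‖(U (φ m) : Mat n)‖⁻¹ : ℝ) : ℂ)) atTop (𝓝 0) := by
    have := (tendsto_inv_atTop_zero.comp hnorm).comp hφ.tendsto_atTop
    exact_mod_cast (Complex.continuous_ofReal.tendsto 0).comp this
  have hzero : Tendsto (fun m => (((‖(U (φ m) : Mat n)‖⁻¹ : ℝ) : ℂ) *
      ((‖(U (φ m) : Mat n)‖⁻¹ : ℝ) : ℂ)) • hermMat n) atTop (𝓝 0) := by
    simpa using (hscal.mul hscal).smul_const (hermMat n)
  refine ⟨B, φ, _, hφ, ?_, ?_, ?_, fun m => ?_, hB⟩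
  · rintro rfl
    have := hB.norm
    simp [hV1] at this
  · have hc : Continuous fun M : Mat n => Mᴴ * hermMat n * M := by fun_prop
    refine tendsto_nhds_unique (((hc.tendsto B).comp hB).congr fun m => ?_) hzero
    simp only [Function.comp_apply, hV, Matrix.conjTranspose_smul, Matrix.smul_mul,
      Matrix.mul_smul, smul_smul, conjTranspose_mul_hermMat_mul (hU _), Complex.star_def,
      Complex.conj_ofReal]
  · have hc : Continuous fun M : Mat n => M * hermMat n * Mᴴ := by fun_prop
    refine tendsto_nhds_unique (((hc.tendsto B).comp hB).congr fun m => ?_) hzero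
    simp only [Function.comp_apply, hV, Matrix.conjTranspose_smul, Matrix.smul_mul,
      Matrix.mul_smul, smul_smul, mul_hermMat_mul_conjTranspose (hU _), Complex.star_def,
      Complex.conj_ofReal]
  · simp [hne (φ m)]

lemma tendsto_actGL_mk {U : ℕ → GLn n} {c : ℕ → ℂ} (hc : ∀ m, c m ≠ 0) {B : Mat n}
    (hB : Tendsto (fun m => c m • (U m : Mat n)) atTop (𝓝 B)) (v : Vec n) (hv : v ≠ 0)
    (hBv : B *ᵥ v ≠ 0) :
    Tendsto (fun m => actGL (U m) (Projectivization.mk ℂ v hv)) atTop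
      (𝓝 (Projectivization.mk ℂ (B *ᵥ v) hBv)) := by
  have hcont : Continuous fun M : Mat n => M *ᵥ v := by fun_prop
  have hne : ∀ m, (c m • (U m : Mat n)) *ᵥ v ≠ 0 := fun m => by
    rw [Matrix.smul_mulVec]
    exact smul_ne_zero (hc m) (mulVec_ne_zero_of_ne_zero _ hv)
  refine (tendsto_mk hne hBv ((hcont.tendsto B).comp hB)).congr fun m => ?_
  rw [actGL_mk, Projectivization.mk_eq_mk_iff']
  exact ⟨c m, (Matrix.smul_mulVec _ _ _).symm⟩

/-- Every point is a limit of points that do not lie in the kernel of `B`. -/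
lemma exists_seq_tendsto_mulVec_ne_zero {B : Mat n} {e : Vec n} (he : B *ᵥ e ≠ 0) (x : Pn n) :
    ∃ (v : ℕ → Vec n) (hv : ∀ j, v j ≠ 0), (∀ j, B *ᵥ v j ≠ 0) ∧
      Tendsto (fun j => Projectivization.mk ℂ (v j) (hv j)) atTop (𝓝 x) := by
  induction x using Projectivization.ind with
  | h x hx =>
    by_cases hBx : B *ᵥ x = 0
    · have hB : ∀ j : ℕ, B *ᵥ (x + (1 / ((j : ℂ) + 1)) • e) ≠ 0 := fun j => by
        rw [Matrix.mulVec_add, hBx, zero_add, Matrix.mulVec_smul]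
        exact smul_ne_zero (one_div_ne_zero (Nat.cast_add_one_ne_zero j)) he
      refine ⟨_, fun j h => hB j (by rw [h, Matrix.mulVec_zero]), hB, tendsto_mk _ hx ?_⟩
      have h0 : Tendsto (fun j : ℕ => 1 / ((j : ℂ) + 1)) atTop (𝓝 0) :=
        tendsto_one_div_add_atTop_nhds_zero_nat
      simpa using (h0.smul_const e).const_add x
    · exact ⟨fun _ => x, fun _ => hx, fun _ => hBx, tendsto_const_nhds⟩

end Normalization

/-- A sequence of distinct elements of a discrete subgroup of `PU(1,n)` subconverges to a constant
`p` on a dense set of points which contains the center of the ball. -/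
lemma exists_subseq_tendsto_const_on_dense {n : ℕ} {G : Subgroup (PGLn n)}
    (hPU : (G : Set (PGLn n)) ⊆ PUset n) (hdisc : DiscreteTopology ↥G)
    {g : ℕ → G} (hg : Function.Injective g) :
    ∃ (p : Pn n) (φ : ℕ → ℕ), StrictMono φ ∧
      Tendsto (fun m => act (g (φ m) : PGLn n) (basePt n)) atTop (𝓝 p) ∧
      ∀ x, ∃ y : ℕ → Pn n, Tendsto y atTop (𝓝 x) ∧
        ∀ j, Tendsto (fun m => act (g (φ m) : PGLn n) (y j)) atTop (𝓝 p) := by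
  choose U hU hUg using fun m => hPU (g m).2
  have hact : ∀ m, act (g m : PGLn n) = actGL (U m) := fun m => by rw [← hUg m, act_mk]
  have hnorm := tendsto_norm_atTop hdisc hg hU hUg
  obtain ⟨B, φ, c, hφ, hB0, hcol, hrow, hc, hB⟩ := exists_subseq_normalized_tendsto hU hnorm
  have he := mulVec_single_zero_ne_zero hrow hB0
  refine ⟨Projectivization.mk ℂ _ he, φ, hφ, ?_, fun x => ?_⟩
  · simp only [hact]
    exact tendsto_actGL_mk hc hB _ _ he
  · obtain ⟨v, hv, hBv, hlim⟩ := exists_seq_tendsto_mulVec_ne_zero he x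
    refine ⟨_, hlim, fun j => ?_⟩
    have hp : Projectivization.mk ℂ _ he = Projectivization.mk ℂ _ (hBv j) := by
      have hpar := mulVec_parallel hcol (v j) (Pi.single 0 1)
      have h0 : (B *ᵥ v j) 0 ≠ 0 := fun h =>
        hBv j (eq_zero_of_herm_self (herm_mulVec_self_eq_zero hcol _) h)
      rw [Projectivization.mk_eq_mk_iff']
      refine ⟨((B *ᵥ v j) 0)⁻¹ * (B *ᵥ Pi.single 0 1) 0, ?_⟩
      rw [mul_smul, ← hpar, inv_smul_smul₀ h0]
    simp only [hact]
    rw [hp]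
    exact tendsto_actGL_mk hc hB _ _ (hBv j)

/-- For a discrete subgroup `G` of `PU(1,n)` and a compact set
`K ⊆ Eq(G)`, every cluster point of the orbit `G ⬝ K` lies in the Chen–Greenberg
limit set: if `(g_m)` is a sequence of distinct elements of `G`, `(k_m)` a sequence
in `K` and `g_m (k_m) → z`, then `z ∈ Λ_CG(G)`. -/
theorem cluster_points_of_orbit_of_compact_in_limit_set
    (n : ℕ) (hn : 1 ≤ n) (G : Subgroup (PGLn n))
    (hPU : (G : Set (PGLn n)) ⊆ PUset n) (hdisc : DiscreteTopology ↥G)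
    (K : Set (Pn n)) (hK : K ⊆ eqRegion G) (hKc : IsCompact K)
    (g : ℕ → G) (hg : Function.Injective g)
    (k : ℕ → Pn n) (hk : ∀ m, k m ∈ K) (z : Pn n)
    (hz : Filter.Tendsto (fun m => act (g m : PGLn n) (k m)) Filter.atTop (nhds z)) :
    z ∈ LambdaCG G := by
  obtain ⟨x, hxK, α, hα, hkx⟩ := hKc.tendsto_subseq hk
  obtain ⟨p, φ, hφ, hbase, hdense⟩ :=
    exists_subseq_tendsto_const_on_dense hPU hdisc (hg.comp hα.injective)
  obtain ⟨U, hU, hxU, hequi⟩ := hK hxK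
  obtain ⟨ψ, hψ, F, hF⟩ := hequi fun m => g (α (φ m))
  have hFp : ∀ y ∈ U, F y = p := fun y hy => by
    obtain ⟨w, hw, hwp⟩ := hdense y
    refine hF.eq_of_tendsto_of_dense hU (fun m => continuous_actGL _) hy hw fun j => ?_
    exact (hwp j).comp hψ.tendsto_atTop
  have hp : Tendsto (fun m => act (g (α (φ (ψ m))) : PGLn n) (k (α (φ (ψ m))))) atTop (𝓝 p) :=
    hF.tendsto_of_eq_const hU hFp hxU (hkx.comp (hφ.comp hψ).tendsto_atTop)
  obtain rfl : z = p :=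
    tendsto_nhds_unique (hz.comp (hα.comp (hφ.comp hψ)).tendsto_atTop) hp
  exact ⟨_, (hg.comp hα.injective).comp hφ.injective, hbase⟩
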